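/- Let G be a 7-contraction-critical graph with no K7^∨-minor. Then any two cliques of G of size five have nonempty intersection. -/

import Mathlib

open SimpleGraph

/-- `K7vee` is the graph obtained from `K 7` by deleting two edges with a common end. -/
def K7vee : SimpleGraph (Fin 7) :=
  (completeGraph (Fin 7)).deleteEdges {s(0, 1), s(0, 2)}

/-- `K6vee` is the graph obtained from `K 6` by deleting two edges with a common end. -/
def K6vee : SimpleGraph (Fin 6) :=
  (completeGraph (Fin 6)).deleteEdges {s(0, 1), s(0, 2)}

/-- The complete multipartite graph with four parts of size two. -/
def K2222 : SimpleGraph (Fin 4 × Fin 2) :=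
  SimpleGraph.comap Prod.fst (completeGraph (Fin 4))

/-- `H` is a minor of `G`: there is a model of `H` in `G`, i.e. a family of pairwise disjoint
nonempty connected branch sets, one for each vertex of `H`, with edges of `G` between branch
sets corresponding to adjacent vertices of `H`. -/
def IsMinor {W V : Type} (H : SimpleGraph W) (G : SimpleGraph V) : Prop :=
  ∃ bag : W → Set V,
    (∀ w, (G.induce (bag w)).Connected) ∧
    (∀ w w', w ≠ w' → Disjoint (bag w) (bag w')) ∧
    (∀ w w', H.Adj w w' → ∃ u ∈ bag w, ∃ v ∈ bag w', G.Adj u v)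

/-- A graph is `k`-connected if it has more than `k` vertices and stays connected after
removing any set of fewer than `k` vertices. -/
def IsKConnected {V : Type} [Fintype V] (k : ℕ) (G : SimpleGraph V) : Prop :=
  k < Fintype.card V ∧ ∀ S : Set V, S.ncard < k → (G.induce (Sᶜ : Set V)).Connected

/-- A separation of `G`: `A ∪ B = V(G)` and no edge joins `A - B` to `B - A`. -/
def IsSeparation {V : Type} (G : SimpleGraph V) (A B : Set V) : Prop :=
  A ∪ B = Set.univ ∧ ∀ ⦃u v : V⦄, G.Adj u v → ¬(u ∈ A \ B ∧ v ∈ B \ A)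

/-- `(G, Z)` is internally `k`-connected: every separation `(A,B)` of `G` with `Z ⊆ A`
and `B - A ≠ ∅` has order at least `k`. -/
def InternallyConnected {V : Type} (G : SimpleGraph V) (Z : Set V) (k : ℕ) : Prop :=
  ∀ A B : Set V, IsSeparation G A B → Z ⊆ A → (B \ A).Nonempty →
    k ≤ (A ∩ B).ncard

/-- A `Z`-rooted `K₄`-model in `G`. -/
def HasRootedK4Model {V : Type} (G : SimpleGraph V) (Z : Set V) : Prop :=
  ∃ B : Fin 4 → Set V,
    (∀ i, (G.induce (B i)).Connected) ∧
    (∀ i j, i ≠ j → Disjoint (B i) (B j)) ∧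
    (∀ i, ∃! z : V, z ∈ Z ∧ z ∈ B i) ∧
    (∀ z ∈ Z, ∃ i, z ∈ B i) ∧
    (∀ i j, i ≠ j → ∃ u ∈ B i, ∃ v ∈ B j, G.Adj u v)

/-- A `Z`-rooted `K*₄,₂`-model in `G`. -/
def HasRootedK42starModel {V : Type} (G : SimpleGraph V) (Z : Set V) : Prop :=
  ∃ (B : Fin 4 → Set V) (C : Fin 2 → Set V),
    (∀ i, (G.induce (B i)).Connected) ∧
    (∀ j, (G.induce (C j)).Connected) ∧
    (∀ i j, i ≠ j → Disjoint (B i) (B j)) ∧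
    (∀ i j, i ≠ j → Disjoint (C i) (C j)) ∧
    (∀ i j, Disjoint (B i) (C j)) ∧
    (∀ i, ∃! z : V, z ∈ Z ∧ z ∈ B i) ∧
    (∀ z ∈ Z, ∃ i, z ∈ B i) ∧
    (∀ i j, ∃ u ∈ B i, ∃ v ∈ C j, G.Adj u v) ∧
    (∃ u ∈ C 0, ∃ v ∈ C 1, G.Adj u v)

/-- An enemy: a `4`-connected graph with `|E(G)| ≥ 4|V(G)| - 8`, with no `K7vee`-minor,
not isomorphic to `K_{2,2,2,2}`. -/
def Enemy {V : Type} [Fintype V] (G : SimpleGraph V) : Prop :=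
  IsKConnected 4 G ∧
    4 * (Fintype.card V : ℤ) - 8 ≤ (G.edgeSet.ncard : ℤ) ∧
    ¬ IsMinor K7vee G ∧
    IsEmpty (G ≃g K2222)

/-- A minor-minimal enemy: an enemy, no minor of which, other than itself, is an enemy. -/
def MinorMinimalEnemy {V : Type} [Fintype V] (G : SimpleGraph V) : Prop :=
  Enemy G ∧ ∀ (W : Type) [Fintype W] (H : SimpleGraph W),
    IsMinor H G → Enemy H → Nonempty (H ≃g G)

/-- The simple graph obtained from `G` by contracting the edge `uv`
(`v` is merged into `u`). -/
def contractEdge {V : Type} (G : SimpleGraph V) (u v : V) :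
    SimpleGraph {x : V // x ≠ v} :=
  SimpleGraph.fromRel (fun x y => G.Adj ↑x ↑y ∨ ((x : V) = u ∧ G.Adj v ↑y))

/-- A graph is `7`-contraction-critical if its chromatic number is `7` and
every minor of it, other than itself, has chromatic number less than `7`. -/
def ContractionCritical7 {V : Type} [Fintype V] (G : SimpleGraph V) : Prop :=
  G.chromaticNumber = 7 ∧
    ∀ (W : Type) [Fintype W] (H : SimpleGraph W),
      IsMinor H G → IsEmpty (H ≃g G) → H.chromaticNumber < 7

section ConnectedSets

variable {V : Type} {G : SimpleGraph V}

lemma connected_induce_singleton (G : SimpleGraph V) (v : V) : (G.induce {v}).Connected := by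
  rw [connected_iff_exists_forall_reachable]
  refine ⟨⟨v, rfl⟩, ?_⟩
  rintro ⟨w, rfl⟩
  rfl

lemma connected_induce_mono {H : SimpleGraph V} (hGH : G ≤ H) {s : Set V}
    (h : (G.induce s).Connected) : (H.induce s).Connected :=
  h.mono fun _ _ huv => hGH huv

/-- A proper nonempty part of a connected set is left by some edge inside that set. -/
lemma exists_adj_leaving {s t : Set V} (hs : (G.induce s).Connected) {a b : V} (ha : a ∈ s)
    (hat : a ∈ t) (hb : b ∈ s) (hbt : b ∉ t) :
    ∃ u ∈ s, ∃ v ∈ s, u ∈ t ∧ v ∉ t ∧ G.Adj u v := by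
  obtain ⟨p⟩ := hs.preconnected ⟨a, ha⟩ ⟨b, hb⟩
  obtain ⟨d, -, h1, h2⟩ := p.exists_boundary_dart {x | (x : V) ∈ t} hat hbt
  exact ⟨d.fst, d.fst.2, d.snd, d.snd.2, h1, h2, d.adj⟩

lemma connected_induce_union_of_adj {s t : Set V} (hs : (G.induce s).Connected)
    (ht : (G.induce t).Connected) {u v : V} (hu : u ∈ s) (hv : v ∈ t) (huv : G.Adj u v) :
    (G.induce (s ∪ t)).Connected := by
  have h1 := induce_union_connected hs.preconnected
    (induce_pair_connected_of_adj huv).preconnected ⟨u, hu, by simp⟩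
  have h2 := induce_union_connected h1.preconnected ht.preconnected ⟨v, by simp, hv⟩
  convert h2 using 2
  all_goals
    ext x
    simp only [Set.mem_union, Set.mem_insert_iff, Set.mem_singleton_iff]
    grind

lemma connected_induce_insert {s : Set V} (hs : (G.induce s).Connected) {u v : V} (hu : u ∈ s)
    (huv : G.Adj u v) : (G.induce (insert v s)).Connected := by
  have := connected_induce_union_of_adj hs (connected_induce_singleton G v) hu rfl huv
  rwa [Set.union_singleton] at this

/-- The vertices joined to `a` by a connected subset of `D`. -/
def reach (G : SimpleGraph V) (D : Set V) (a : V) : Set V :=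
  ⋃₀ {T | T ⊆ D ∧ (G.induce T).Connected ∧ a ∈ T}

lemma subset_reach {D T : Set V} {a : V} (hT : T ⊆ D) (hc : (G.induce T).Connected)
    (ha : a ∈ T) : T ⊆ reach G D a :=
  Set.subset_sUnion_of_mem ⟨hT, hc, ha⟩

lemma reach_subset (G : SimpleGraph V) (D : Set V) (a : V) : reach G D a ⊆ D :=
  Set.sUnion_subset fun _ h => h.1

lemma mem_reach_self {D : Set V} {a : V} (ha : a ∈ D) : a ∈ reach G D a :=
  subset_reach (by simpa using ha) (connected_induce_singleton G a) rfl rfl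

lemma connected_reach {D : Set V} {a : V} (ha : a ∈ D) : (G.induce (reach G D a)).Connected :=
  induce_sUnion_connected_of_pairwise_not_disjoint
    ⟨{a}, by simpa using ha, connected_induce_singleton G a, rfl⟩
    (fun hs ht => ⟨a, hs.2.2, ht.2.2⟩) (fun hs => hs.2.1)

lemma mem_reach_of_adj {D : Set V} {a u v : V} (ha : a ∈ D) (hu : u ∈ reach G D a) (hv : v ∈ D)
    (huv : G.Adj u v) : v ∈ reach G D a :=
  subset_reach (Set.insert_subset hv (reach_subset G D a))
    (connected_induce_insert (connected_reach ha) hu huv)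
    (Set.mem_insert_of_mem _ (mem_reach_self ha)) (Set.mem_insert _ _)

/-- Deleting from a connected set the component of `a` in the complement of `b` leaves a
connected set. -/
lemma connected_diff_reach {U : Set V} (hU : (G.induce U).Connected) {a b : V} (ha : a ∈ U)
    (hb : b ∈ U) (hab : a ≠ b) : (G.induce (U \ reach G (U \ {b}) a)).Connected := by
  have hbC : b ∉ reach G (U \ {b}) a := fun h => (reach_subset _ _ _ h).2 rfl
  have haD : a ∈ U \ {b} := ⟨ha, hab⟩
  refine induce_connected_of_patches b ⟨hb, hbC⟩ ?_
  intro v hv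
  rcases eq_or_ne v b with rfl | hvb
  · exact ⟨{v}, by simpa using hv, rfl, rfl, Reachable.refl _⟩
  have hvD : v ∈ U \ {b} := ⟨hv.1, hvb⟩
  have hbv : b ∉ reach G (U \ {b}) v := fun h => (reach_subset _ _ _ h).2 rfl
  obtain ⟨x, hx, y, hy, hxr, hyr, hxy⟩ :=
    exists_adj_leaving (t := reach G (U \ {b}) v) hU hv.1 (mem_reach_self hvD) hb hbv
  have hyb : y = b := by
    by_contra h
    exact hyr (mem_reach_of_adj hvD hxr ⟨hy, h⟩ hxy)
  subst hyb
  refine ⟨insert y (reach G (U \ {y}) v), ?_, Set.mem_insert _ _,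
    Set.mem_insert_of_mem _ (mem_reach_self hvD),
    (connected_induce_insert (connected_reach hvD) hxr hxy).preconnected _ _⟩
  refine Set.insert_subset ⟨hb, hbC⟩ fun w hw => ⟨(reach_subset _ _ _ hw).1, fun hwa => ?_⟩
  have hun := induce_union_connected (connected_reach (G := G) haD).preconnected
    (connected_reach (G := G) hvD).preconnected ⟨w, hwa, hw⟩
  exact hv.2 (subset_reach (Set.union_subset (reach_subset _ _ _) (reach_subset _ _ _)) hun
    (Or.inl (mem_reach_self haD)) (Or.inr (mem_reach_self hvD)))

lemma mem_reach_or_mem_reach {U : Set V} (hU : (G.induce U).Connected) {a b v : V} (ha : a ∈ U)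
    (hb : b ∈ U) (hab : a ≠ b) (hv : v ∈ U) :
    v ∈ reach G (U \ {b}) a ∨ v ∈ reach G (U \ {a}) b := by
  by_contra! h
  refine h.1 (subset_reach (T := U \ reach G (U \ {a}) b) ?_
    (connected_diff_reach hU hb ha hab.symm) ⟨ha, fun h' => (reach_subset _ _ _ h').2 rfl⟩
    ⟨hv, h.2⟩)
  rintro w ⟨hw, hwb⟩
  refine ⟨hw, ?_⟩
  rintro rfl
  exact hwb (mem_reach_self ⟨hb, hab.symm⟩)

end ConnectedSets

section Menger

variable {V : Type}

/-- The spanning subgraph whose edges are the edges of `G` with both ends in `X`. -/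
def edgesWithin (G : SimpleGraph V) (X : Set V) : SimpleGraph V where
  Adj u v := G.Adj u v ∧ u ∈ X ∧ v ∈ X
  symm := ⟨fun _ _ h => ⟨h.1.symm, h.2.2, h.2.1⟩⟩
  loopless := ⟨fun _ h => h.1.ne rfl⟩

lemma edgesWithin_le (G : SimpleGraph V) (X : Set V) : edgesWithin G X ≤ G := fun _ _ h => h.1

lemma subset_of_connected_edgesWithin {G : SimpleGraph V} {X P : Set V}
    (hP : ((edgesWithin G X).induce P).Connected) {a : V} (haP : a ∈ P) (haX : a ∈ X) :
    P ⊆ X := by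
  intro v hv
  by_contra hvX
  obtain ⟨u, -, w, -, -, hw, hadj⟩ := exists_adj_leaving hP haP haX hv hvX
  exact hw hadj.2.2

lemma IsSeparation.symm {G : SimpleGraph V} {X Y : Set V} (h : IsSeparation G X Y) :
    IsSeparation G Y X :=
  ⟨by rw [Set.union_comm]; exact h.1, fun _ _ huv hh => h.2 huv.symm ⟨hh.2, hh.1⟩⟩

/-- There are `k` pairwise disjoint connected sets, each meeting both `A` and `B`. -/
def HasLinkage (G : SimpleGraph V) (A B : Set V) (k : ℕ) : Prop :=
  ∃ P : Fin k → Set V, (∀ i, (G.induce (P i)).Connected) ∧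
    (∀ i j, i ≠ j → Disjoint (P i) (P j)) ∧
    (∀ i, (P i ∩ A).Nonempty) ∧ (∀ i, (P i ∩ B).Nonempty)

/-- Every separation of `G` with `A` on one side and `B` on the other has order at least `k`. -/
def SeparationBound (G : SimpleGraph V) (A B : Set V) (k : ℕ) : Prop :=
  ∀ X Y : Set V, IsSeparation G X Y → A ⊆ X → B ⊆ Y → k ≤ (X ∩ Y).ncard

lemma IsSeparation.of_edgesWithin {G : SimpleGraph V} {X Y X' Y' : Set V}
    (h : IsSeparation G X Y) (h' : IsSeparation (edgesWithin G X) X' Y') :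
    IsSeparation G (X' ∩ X) (Y' ∪ Y) := by
  refine ⟨?_, ?_⟩
  · ext v
    have h1 : v ∈ X ∪ Y := h.1 ▸ Set.mem_univ v
    have h2 : v ∈ X' ∪ Y' := h'.1 ▸ Set.mem_univ v
    simp only [Set.mem_union, Set.mem_inter_iff, Set.mem_univ, iff_true] at *
    tauto
  · intro u v huv hh
    have h1 := h.2 huv
    have h2 : u ∈ X ∧ v ∈ X → ¬(u ∈ X' \ Y' ∧ v ∈ Y' \ X') := fun hx =>
      h'.2 (show (edgesWithin G X).Adj u v from ⟨huv, hx⟩)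
    have h3 : v ∈ X ∪ Y := h.1 ▸ Set.mem_univ v
    have h4 : v ∈ X' ∪ Y' := h'.1 ▸ Set.mem_univ v
    simp only [Set.mem_union, Set.mem_inter_iff, Set.mem_sdiff] at *
    tauto

lemma inter_union_subset_of_inter_subset {X Y X' Y' : Set V} (h : X ∩ Y ⊆ Y') :
    (X' ∩ X) ∩ (Y' ∪ Y) ⊆ X' ∩ Y' := by
  rintro v ⟨⟨h1, h2⟩, h3 | h3⟩
  · exact ⟨h1, h3⟩
  · exact ⟨h1, h ⟨h2, h3⟩⟩

/-- A linkage from `A ⊆ X` onto all of `T`, inside `X`, indexed by the vertices of `T`. -/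
lemma HasLinkage.exists_bags {G : SimpleGraph V} [Finite V] {A X T : Set V} (hA : A ⊆ X)
    (h : HasLinkage (edgesWithin G X) A T T.ncard) :
    ∃ B : V → Set V, ∀ t ∈ T, (G.induce (B t)).Connected ∧ B t ⊆ X ∧ B t ∩ T = {t} ∧
      (B t ∩ A).Nonempty ∧ ∀ t' ∈ T, t ≠ t' → Disjoint (B t) (B t') := by
  obtain ⟨P, hc, hd, hPA, hPT⟩ := h
  choose f hf using hPT
  have hinj : Function.Injective fun i => (⟨f i, (hf i).2⟩ : T) := by
    intro i j hij
    by_contra hne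
    have : f i = f j := congrArg Subtype.val hij
    exact Set.disjoint_left.1 (hd i j hne) (hf i).1 (this ▸ (hf j).1)
  have hbij : Function.Bijective fun i => (⟨f i, (hf i).2⟩ : T) := by
    have := Fintype.ofFinite T
    refine (Fintype.bijective_iff_injective_and_card _).2 ⟨hinj, ?_⟩
    rw [Fintype.card_fin, ← Nat.card_eq_fintype_card]
    rfl
  have hg : ∀ t : V, ∃ B : Set V, t ∈ T → ∃ j, B = P j ∧ f j = t := by
    intro t
    by_cases ht : t ∈ T
    · obtain ⟨j, hj⟩ := hbij.2 ⟨t, ht⟩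
      exact ⟨P j, fun _ => ⟨j, rfl, congrArg Subtype.val hj⟩⟩
    · exact ⟨∅, fun h => absurd h ht⟩
  choose B hB using hg
  refine ⟨B, fun t ht => ?_⟩
  obtain ⟨j, hj, rfl⟩ := hB t ht
  rw [hj]
  obtain ⟨a, haP, haA⟩ := hPA j
  refine ⟨connected_induce_mono (edgesWithin_le G X) (hc j), subset_of_connected_edgesWithin (hc j) haP (hA haA), ?_,
    ⟨a, haP, haA⟩, ?_⟩
  · ext t'
    constructor
    · rintro ⟨h1, h2⟩
      obtain ⟨j', hj', rfl⟩ := hB t' h2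
      by_contra hne
      exact Set.disjoint_left.1 (hd j j' fun h => hne (by rw [h]; rfl)) h1 (hf j').1
    · rintro rfl
      exact hf j
  · intro t' ht' hne
    obtain ⟨j', hj', rfl⟩ := hB t' ht'
    rw [hj']
    exact hd j j' fun h => hne (by rw [h])

/-- Two families of sets that meet along a separation fit together to a linkage. -/
lemma hasLinkage_of_bags {G : SimpleGraph V} [Finite V] {A B X Y : Set V} {x y : V}
    (hx : x ∉ Y) (hy : y ∉ X) (hxy : G.Adj x y) {P Q : V → Set V}
    (hP : ∀ t ∈ insert x (X ∩ Y), (G.induce (P t)).Connected ∧ P t ⊆ X ∧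
      P t ∩ insert x (X ∩ Y) = {t} ∧ (P t ∩ A).Nonempty ∧
      ∀ t' ∈ insert x (X ∩ Y), t ≠ t' → Disjoint (P t) (P t'))
    (hQ : ∀ t ∈ insert y (X ∩ Y), (G.induce (Q t)).Connected ∧ Q t ⊆ Y ∧
      Q t ∩ insert y (X ∩ Y) = {t} ∧ (Q t ∩ B).Nonempty ∧
      ∀ t' ∈ insert y (X ∩ Y), t ≠ t' → Disjoint (Q t) (Q t')) :
    HasLinkage G A B ((X ∩ Y).ncard + 1) := by
  classical
  set S := X ∩ Y with hS
  have hxS : x ∉ S := fun h => hx h.2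
  have hyS : y ∉ S := fun h => hy h.1
  let φ : V → V := fun t => if t = x then y else t
  have hφx : φ x = y := if_pos rfl
  have hφ : ∀ t ∈ S, φ t = t := by
    intro t ht
    refine if_neg ?_
    rintro rfl
    exact hxS ht
  have hφmem : ∀ t ∈ insert x S, φ t ∈ insert y S := by
    rintro t (rfl | ht)
    · exact Or.inl hφx
    · exact Or.inr ((hφ t ht).symm ▸ ht)
  have hφinj : ∀ t ∈ insert x S, ∀ t' ∈ insert x S, t ≠ t' → φ t ≠ φ t' := by
    rintro t (rfl | ht) t' (rfl | ht') hne
    · exact absurd rfl hne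
    · rw [hφx, hφ t' ht']
      exact fun h => hyS (h ▸ ht')
    · rw [hφx, hφ t ht]
      rintro rfl
      exact hyS ht
    · rwa [hφ t ht, hφ t' ht']
  have hcross : ∀ t ∈ insert x S, ∀ t' ∈ insert x S, t ≠ t' → Disjoint (P t) (Q (φ t')) := by
    intro t ht t' ht' hne
    rw [Set.disjoint_left]
    intro v hvP hvQ
    have hvS : v ∈ S := ⟨(hP t ht).2.1 hvP, (hQ _ (hφmem t' ht')).2.1 hvQ⟩
    have h1 : v ∈ ({t} : Set V) := (hP t ht).2.2.1 ▸ ⟨hvP, Or.inr hvS⟩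
    have h2 : v ∈ ({φ t'} : Set V) := (hQ _ (hφmem t' ht')).2.2.1 ▸ ⟨hvQ, Or.inr hvS⟩
    rw [Set.mem_singleton_iff] at h1 h2
    rcases ht' with rfl | ht'
    · exact hyS (hφx ▸ h2 ▸ hvS)
    · exact hne (by rw [← h1, h2, hφ t' ht'])
  have hcard : (insert x S).ncard = S.ncard + 1 := Set.ncard_insert_of_notMem hxS
  have := Fintype.ofFinite (insert x S : Set V)
  have e : Fin (S.ncard + 1) ≃ (insert x S : Set V) := by
    refine (Fintype.equivFinOfCardEq ?_).symm
    rw [← hcard, ← Nat.card_eq_fintype_card]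
    rfl
  refine ⟨fun i => P (e i) ∪ Q (φ (e i)), fun i => ?_, fun i j hij => ?_, fun i => ?_, fun i => ?_⟩
  · have hmem := (e i).2
    have hself : ((e i : V)) ∈ P (e i) := by
      have : (e i : V) ∈ P (e i) ∩ insert x S := (hP _ hmem).2.2.1 ▸ rfl
      exact this.1
    have hself' : φ (e i) ∈ Q (φ (e i)) := by
      have : φ (e i) ∈ Q (φ (e i)) ∩ insert y S := (hQ _ (hφmem _ hmem)).2.2.1 ▸ rfl
      exact this.1
    have hcP := (hP _ hmem).1
    have hcQ := (hQ _ (hφmem _ hmem)).1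
    rcases hmem with h | h
    · refine connected_induce_union_of_adj hcP hcQ hself hself' ?_
      rw [h, hφx]
      exact hxy
    · refine induce_union_connected hcP.preconnected hcQ.preconnected ⟨e i, hself, ?_⟩
      rwa [hφ _ h] at hself' ⊢
  · have hne : (e i : V) ≠ e j := fun h => hij (e.injective (Subtype.ext h))
    have hi := (e i).2
    have hj := (e j).2
    simp only [Set.disjoint_union_left, Set.disjoint_union_right]
    exact ⟨⟨(hP _ hi).2.2.2.2 _ hj hne, (hcross _ hj _ hi hne.symm).symm⟩, hcross _ hi _ hj hne,
      (hQ _ (hφmem _ hi)).2.2.2.2 _ (hφmem _ hj) (hφinj _ hi _ hj hne)⟩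
  · exact (hP _ (e i).2).2.2.2.1.mono (Set.inter_subset_inter_left _ Set.subset_union_left)
  · exact (hQ _ (hφmem _ (e i).2)).2.2.2.1.mono
      (Set.inter_subset_inter_left _ Set.subset_union_right)

lemma HasLinkage.mono {G H : SimpleGraph V} (hGH : G ≤ H) {A B : Set V} {k : ℕ}
    (h : HasLinkage G A B k) : HasLinkage H A B k := by
  obtain ⟨P, hc, h⟩ := h
  exact ⟨P, fun i => connected_induce_mono hGH (hc i), h⟩

lemma HasLinkage.of_le {G : SimpleGraph V} {A B : Set V} {k l : ℕ} (hkl : k ≤ l)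
    (h : HasLinkage G A B l) : HasLinkage G A B k := by
  obtain ⟨P, hc, hd, hA, hB⟩ := h
  exact ⟨fun i => P (i.castLE hkl), fun i => hc _,
    fun i j hij => hd _ _ fun h => hij (Fin.castLE_injective hkl h), fun i => hA _, fun i => hB _⟩

lemma hasLinkage_inter (G : SimpleGraph V) [Finite V] (A B : Set V) :
    HasLinkage G A B (A ∩ B).ncard := by
  have := Fintype.ofFinite (A ∩ B : Set V)
  have e : Fin (A ∩ B).ncard ≃ (A ∩ B : Set V) := by
    refine (Fintype.equivFinOfCardEq ?_).symm
    rw [← Nat.card_eq_fintype_card]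
    rfl
  refine ⟨fun i => {(e i : V)}, fun i => connected_induce_singleton G _, fun i j hij => ?_,
    fun i => ⟨e i, rfl, (e i).2.1⟩, fun i => ⟨e i, rfl, (e i).2.2⟩⟩
  simpa using fun h => hij (e.injective (Subtype.ext h))

/-- Menger's theorem for sets of vertices, with connected sets in place of paths. -/
theorem SeparationBound.hasLinkage [Finite V] (G : SimpleGraph V) (A B : Set V) (k : ℕ)
    (h : SeparationBound G A B k) : HasLinkage G A B k := by
  induction G using WellFoundedLT.induction generalizing A B k with
  | ind G ih =>
  by_cases hbot : G = ⊥
  · subst hbot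
    refine (hasLinkage_inter _ A B).of_le ?_
    refine (h A (Aᶜ ∪ B) ⟨?_, fun _ _ h => h.elim⟩ subset_rfl Set.subset_union_right).trans_eq ?_
    · rw [← Set.union_assoc, Set.union_compl_self, Set.univ_union]
    · rw [Set.inter_union_distrib_left, Set.inter_compl_self, Set.empty_union]
  obtain ⟨x₀, y₀, hxy₀⟩ : ∃ x y, G.Adj x y := by
    by_contra! hno
    exact hbot (by ext u v; simpa using hno u v)
  set G' := G.deleteEdges {s(x₀, y₀)} with hG'
  have hle : G' ≤ G := deleteEdges_le _
  have hlt : G' < G := by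
    refine lt_of_le_of_ne hle fun heq => ?_
    have : G'.Adj x₀ y₀ := heq ▸ hxy₀
    simp [hG'] at this
  by_cases hb : SeparationBound G' A B k
  · exact (ih G' hlt A B k hb).mono hle
  unfold SeparationBound at hb
  push Not at hb
  obtain ⟨X, Y, hsep, hAX, hBY, hlt'⟩ := hb
  have hadj : ∀ u v, G.Adj u v → ¬ G'.Adj u v → (u = x₀ ∧ v = y₀) ∨ (u = y₀ ∧ v = x₀) := by
    intro u v huv hn
    by_contra hcon
    exact hn (by simp only [hG', deleteEdges_adj, Set.mem_singleton_iff, Sym2.eq_iff]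
                 exact ⟨huv, hcon⟩)
  obtain ⟨x, y, hxy, hxX, hxY, hyY, hyX, hedge⟩ : ∃ x y, G.Adj x y ∧ x ∈ X ∧ x ∉ Y ∧ y ∈ Y ∧
      y ∉ X ∧ ∀ u v, G.Adj u v → ¬ G'.Adj u v → (u = x ∧ v = y) ∨ (u = y ∧ v = x) := by
    by_contra hcon
    refine absurd (h X Y ⟨hsep.1, fun u v huv hh => ?_⟩ hAX hBY) (not_le.2 hlt')
    by_cases hG : G'.Adj u v
    · exact hsep.2 hG hh
    · refine hcon ⟨u, v, huv, hh.1.1, hh.1.2, hh.2.1, hh.2.2, fun u' v' h1 h2 => ?_⟩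
      have := hadj u v huv hG
      have := hadj u' v' h1 h2
      grind
  have hsepx : IsSeparation G X (insert x Y) := by
    refine ⟨?_, fun u v huv hh => ?_⟩
    · rw [Set.union_insert, hsep.1, Set.insert_eq_of_mem (Set.mem_univ x)]
    · by_cases hG : G'.Adj u v
      · exact hsep.2 hG ⟨⟨hh.1.1, fun h => hh.1.2 (Or.inr h)⟩, hh.2.1.resolve_left
          (fun h => hh.2.2 (h ▸ hxX)), hh.2.2⟩
      · rcases hedge u v huv hG with ⟨rfl, rfl⟩ | ⟨rfl, rfl⟩
        · exact hh.1.2 (Or.inl rfl)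
        · exact hyX hh.1.1
  have hcard : (X ∩ Y).ncard + 1 = k := by
    have h1 := h X (insert x Y) hsepx hAX (hBY.trans (Set.subset_insert _ _))
    rw [Set.inter_insert_of_mem hxX] at h1
    have h2 := Set.ncard_insert_of_notMem (s := X ∩ Y) (a := x) fun h => hxY h.2
    omega
  have hxcard : (insert x (X ∩ Y)).ncard = k := by
    rw [Set.ncard_insert_of_notMem fun h => hxY h.2, hcard]
  have hycard : (insert y (X ∩ Y)).ncard = k := by
    rw [Set.ncard_insert_of_notMem fun h => hyX h.1, hcard]
  have hltX : edgesWithin G' X < G := (edgesWithin_le _ _).trans_lt hlt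
  have hltY : edgesWithin G' Y < G := (edgesWithin_le _ _).trans_lt hlt
  have lift : ∀ Z W, IsSeparation G' Z W → x ∈ W → y ∈ W → IsSeparation G Z W := by
    intro Z W hZ hxW hyW
    refine ⟨hZ.1, fun u v huv hh => ?_⟩
    by_cases hG : G'.Adj u v
    · exact hZ.2 hG hh
    · rcases hedge u v huv hG with ⟨rfl, rfl⟩ | ⟨rfl, rfl⟩
      · exact hh.1.2 hxW
      · exact hh.1.2 hyW
  obtain ⟨P, hP⟩ := HasLinkage.exists_bags (G := G') hAX <|
    ih (edgesWithin G' X) hltX A (insert x (X ∩ Y)) _ <| by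
      intro X' Y' hs hA' hT'
      rw [hxcard]
      have hST : X ∩ Y ⊆ Y' := (Set.subset_insert _ _).trans hT'
      refine (h _ _ (lift _ _ (hsep.of_edgesWithin hs) (Or.inl (hT' (Or.inl rfl))) (Or.inr hyY))
        (Set.subset_inter hA' hAX) (hBY.trans Set.subset_union_right)).trans ?_
      exact Set.ncard_le_ncard (inter_union_subset_of_inter_subset hST) (Set.toFinite _)
  obtain ⟨Q, hQ⟩ := HasLinkage.exists_bags (G := G') hBY <|
    ih (edgesWithin G' Y) hltY B (insert y (X ∩ Y)) _ <| by
      intro X' Y' hs hB' hT'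
      rw [hycard]
      have hST : Y ∩ X ⊆ Y' := by
        rw [Set.inter_comm]
        exact (Set.subset_insert _ _).trans hT'
      have h1 := (lift _ _ (hsep.symm.of_edgesWithin hs) (Or.inr hxX)
        (Or.inl (hT' (Or.inl rfl)))).symm
      refine (h _ _ h1 (hAX.trans Set.subset_union_right) (Set.subset_inter hB' hBY)).trans ?_
      rw [Set.inter_comm]
      exact Set.ncard_le_ncard (inter_union_subset_of_inter_subset hST) (Set.toFinite _)
  rw [← hcard]
  exact hasLinkage_of_bags hxY hyX hxy
    (fun t ht => ⟨connected_induce_mono hle (hP t ht).1, (hP t ht).2⟩)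
    (fun t ht => ⟨connected_induce_mono hle (hQ t ht).1, (hQ t ht).2⟩)

end Menger

section Critical

variable {V : Type}

/-- Contracting disjoint connected sets, each meeting `Y` in one vertex of `S`, makes the set `S`
a clique without identifying vertices of `Y`. -/
def ContractsToClique (G : SimpleGraph V) (Y S : Set V) : Prop :=
  ∃ B : V → Set V, (∀ s ∈ S, (G.induce (B s)).Connected ∧ B s ∩ Y = {s}) ∧
    ∀ s ∈ S, ∀ t ∈ S, s ≠ t → Disjoint (B s) (B t) ∧ ∃ u ∈ B s, ∃ v ∈ B t, G.Adj u v

lemma contractsToClique_of_isClique {G : SimpleGraph V} {Y S : Set V} (hSY : S ⊆ Y)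
    (hS : ∀ s ∈ S, ∀ t ∈ S, s ≠ t → G.Adj s t) : ContractsToClique G Y S := by
  refine ⟨fun s => {s}, fun s hs => ⟨connected_induce_singleton G s, ?_⟩, fun s hs t ht hst =>
    ⟨by simpa using hst, s, rfl, t, rfl, hS s hs t ht hst⟩⟩
  exact Set.inter_eq_left.2 (by simpa using hSY hs)

lemma contractsToClique_pair {G : SimpleGraph V} {Y T : Set V} {a b u : V} (ha : a ∈ Y)
    (hT : (G.induce T).Connected) (hTY : T ∩ Y = {b}) (haT : a ∉ T) (hu : u ∈ T)
    (hau : G.Adj a u) : ContractsToClique G Y {a, b} := by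
  classical
  have hbT : b ∈ T := by
    have : b ∈ T ∩ Y := hTY ▸ rfl
    exact this.1
  have hab : b ≠ a := by
    rintro rfl
    exact haT hbT
  obtain ⟨B, hBa, hBb⟩ : ∃ B : V → Set V, B a = {a} ∧ B b = T :=
    ⟨fun s => if s = a then {a} else T, if_pos rfl, if_neg hab⟩
  refine ⟨B, ?_, ?_⟩
  · rintro s (rfl | rfl)
    · rw [hBa]
      exact ⟨connected_induce_singleton G s, Set.inter_eq_left.2 (by simpa using ha)⟩
    · rw [hBb]
      exact ⟨hT, hTY⟩
  · rintro s (rfl | rfl) t (rfl | rfl) hst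
    · exact absurd rfl hst
    · rw [hBa, hBb]
      exact ⟨by simpa using haT, s, rfl, u, hu, hau⟩
    · rw [hBa, hBb]
      exact ⟨by simpa using haT, u, hu, t, rfl, hau.symm⟩
    · exact absurd rfl hst

lemma ContractionCritical7.exists_coloring [Fintype V] {G : SimpleGraph V}
    (hG : ContractionCritical7 G) {Y S : Set V} (hY : Y ≠ Set.univ)
    (h : ContractsToClique G Y S) :
    ∃ c : V → Fin 6, (∀ u ∈ Y, ∀ v ∈ Y, G.Adj u v → c u ≠ c v) ∧ Set.InjOn c S := by
  classical
  obtain ⟨B, hB, hBB⟩ := h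
  have hSY : S ⊆ Y := fun s hs => by
    have : s ∈ B s ∩ Y := (hB s hs).2 ▸ rfl
    exact this.2
  have hself : ∀ s ∈ S, s ∈ B s := fun s hs => by
    have : s ∈ B s ∩ Y := (hB s hs).2 ▸ rfl
    exact this.1
  let bag : Y → Set V := fun v => if (v : V) ∈ S then B v else {(v : V)}
  have hbagS : ∀ v : Y, (v : V) ∈ S → bag v = B v := fun v hv => if_pos hv
  have hbagN : ∀ v : Y, (v : V) ∉ S → bag v = {(v : V)} := fun v hv => if_neg hv
  have hmem : ∀ v : Y, (v : V) ∈ bag v := by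
    intro v
    by_cases hv : (v : V) ∈ S
    · rw [hbagS v hv]
      exact hself v hv
    · rw [hbagN v hv]
      rfl
  have hbagY : ∀ v : Y, ∀ w ∈ bag v, w ∈ Y → w = v := by
    intro v w hw hwY
    by_cases hv : (v : V) ∈ S
    · rw [hbagS v hv] at hw
      have : w ∈ ({(v : V)} : Set V) := (hB v hv).2 ▸ ⟨hw, hwY⟩
      exact this
    · rw [hbagN v hv] at hw
      exact hw
  let H : SimpleGraph Y :=
    { Adj := fun v w => v ≠ w ∧ ∃ x ∈ bag v, ∃ y ∈ bag w, G.Adj x y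
      symm := ⟨fun v w h => by
        obtain ⟨hne, x, hx, y, hy, hxy⟩ := h
        exact ⟨hne.symm, y, hy, x, hx, hxy.symm⟩⟩
      loopless := ⟨fun v h => h.1 rfl⟩ }
  have hminor : IsMinor H G := by
    refine ⟨bag, fun v => ?_, fun v w hvw => ?_, fun v w hvw => hvw.2⟩
    · by_cases hv : (v : V) ∈ S
      · rw [hbagS v hv]
        exact (hB v hv).1
      · rw [hbagN v hv]
        exact connected_induce_singleton G _
    · have hvw' : (v : V) ≠ w := fun h => hvw (Subtype.ext h)
      by_cases hv : (v : V) ∈ S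
      · by_cases hw : (w : V) ∈ S
        · rw [hbagS v hv, hbagS w hw]
          exact (hBB v hv w hw hvw').1
        · rw [hbagN w hw, Set.disjoint_singleton_right]
          exact fun h => hvw' (hbagY v w h w.2).symm
      · rw [hbagN v hv, Set.disjoint_singleton_left]
        exact fun h => hvw' (hbagY w v h v.2)
  have hiso : IsEmpty (H ≃g G) := by
    refine ⟨fun e => hY ?_⟩
    have h1 : Nat.card Y = Nat.card V := Nat.card_congr e.toEquiv
    refine Set.eq_of_subset_of_ncard_le (Set.subset_univ Y) ?_ (Set.toFinite _)
    rw [Set.ncard_univ, ← h1]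
    rfl
  have hcol : H.Colorable 6 := by
    rw [← chromaticNumber_le_iff_colorable]
    exact Order.le_of_lt_add_one (hG.2 Y H hminor hiso)
  obtain ⟨c⟩ := hcol
  refine ⟨fun v => if hv : v ∈ Y then c ⟨v, hv⟩ else 0, ?_, ?_⟩
  · intro u hu v hv huv
    simp only [dif_pos hu, dif_pos hv]
    exact c.valid ⟨fun h => huv.ne (congrArg Subtype.val h), u, hmem _, v, hmem _, huv⟩
  · intro u hu v hv huv
    simp only [dif_pos (hSY hu), dif_pos (hSY hv)] at huv
    by_contra hne
    refine c.valid (v := ⟨u, hSY hu⟩) (w := ⟨v, hSY hv⟩)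
      ⟨fun h => hne (congrArg Subtype.val h), ?_⟩ huv
    rw [hbagS _ hu, hbagS _ hv]
    exact (hBB u hu v hv hne).2

/-- Colourings that are injective on a set agree there up to a permutation of the colours. -/
lemma exists_perm_comp_eq {n : ℕ} {S : Set V} {c d : V → Fin n} (hc : Set.InjOn c S)
    (hd : Set.InjOn d S) : ∃ σ : Equiv.Perm (Fin n), ∀ s ∈ S, σ (d s) = c s := by
  classical
  let e : {x // x ∈ d '' S} ≃ {x // x ∈ c '' S} :=
    (Equiv.Set.imageOfInjOn d S hd).symm.trans (Equiv.Set.imageOfInjOn c S hc)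
  refine ⟨e.extendSubtype, fun s hs => ?_⟩
  rw [Equiv.extendSubtype_apply_of_mem e (d s) ⟨s, hs, rfl⟩]
  have : (Equiv.Set.imageOfInjOn d S hd).symm ⟨d s, s, hs, rfl⟩ = ⟨s, hs⟩ := by
    rw [Equiv.symm_apply_eq]
    rfl
  simp only [e, Equiv.trans_apply, this]
  rfl

lemma ContractionCritical7.not_colorable [Fintype V] {G : SimpleGraph V}
    (hG : ContractionCritical7 G) : ¬ G.Colorable 6 := by
  rw [← chromaticNumber_le_iff_colorable, hG.1]
  decide

/-- A contraction-critical graph has no separation whose intersection can be contracted to a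
clique from either side. -/
lemma ContractionCritical7.false_of_separation [Fintype V] {G : SimpleGraph V}
    (hG : ContractionCritical7 G) {X Y : Set V} (hsep : IsSeparation G X Y)
    (hX : X ≠ Set.univ) (hY : Y ≠ Set.univ) (hXS : ContractsToClique G X (X ∩ Y))
    (hYS : ContractsToClique G Y (X ∩ Y)) : False := by
  classical
  obtain ⟨c, hc, hcS⟩ := hG.exists_coloring hX hXS
  obtain ⟨d, hd, hdS⟩ := hG.exists_coloring hY hYS
  obtain ⟨σ, hσ⟩ := exists_perm_comp_eq hcS hdS
  refine hG.not_colorable ⟨Coloring.mk (fun v => if v ∈ X then c v else σ (d v)) ?_⟩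
  have hvY : ∀ v ∈ Y, (if v ∈ X then c v else σ (d v)) = σ (d v) := by
    intro v hv
    by_cases hvX : v ∈ X
    · rw [if_pos hvX, hσ v ⟨hvX, hv⟩]
    · rw [if_neg hvX]
  intro u v huv
  have h1 := hsep.2 huv
  have h2 := hsep.2 huv.symm
  have hu : u ∈ X ∪ Y := hsep.1 ▸ Set.mem_univ u
  have hv : v ∈ X ∪ Y := hsep.1 ▸ Set.mem_univ v
  have hboth : (u ∈ X ∧ v ∈ X) ∨ (u ∈ Y ∧ v ∈ Y) := by
    simp only [Set.mem_union, Set.mem_sdiff] at *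
    tauto
  rcases hboth with ⟨hu, hv⟩ | ⟨hu, hv⟩
  · rw [if_pos hu, if_pos hv]
    exact hc u hu v hv huv
  · rw [hvY u hu, hvY v hv]
    exact fun h => hd u hu v hv huv (σ.injective h)

lemma contractsToClique_of_bags {G : SimpleGraph V} {A X Y : Set V}
    (hA : ∀ u ∈ A, ∀ v ∈ A, u ≠ v → G.Adj u v) {B : V → Set V}
    (hB : ∀ t ∈ X ∩ Y, (G.induce (B t)).Connected ∧ B t ⊆ X ∧ B t ∩ (X ∩ Y) = {t} ∧
      (B t ∩ A).Nonempty ∧ ∀ t' ∈ X ∩ Y, t ≠ t' → Disjoint (B t) (B t')) :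
    ContractsToClique G Y (X ∩ Y) := by
  refine ⟨B, fun s hs => ⟨(hB s hs).1, ?_⟩, fun s hs t ht hst =>
    ⟨(hB s hs).2.2.2.2 t ht hst, ?_⟩⟩
  · rw [← (hB s hs).2.2.1, ← Set.inter_assoc, Set.inter_eq_left.2 (hB s hs).2.1]
  · obtain ⟨u, hu, huA⟩ := (hB s hs).2.2.2.1
    obtain ⟨v, hv, hvA⟩ := (hB t ht).2.2.2.1
    refine ⟨u, hu, v, hv, hA u huA v hvA ?_⟩
    rintro rfl
    exact Set.disjoint_left.1 ((hB s hs).2.2.2.2 t ht hst) hu hv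

/-- Two cliques of size `k` of a contraction-critical graph are joined by `k` disjoint connected
sets. -/
lemma ContractionCritical7.hasLinkage [Fintype V] {G : SimpleGraph V}
    (hG : ContractionCritical7 G) {A B : Set V} {k : ℕ} (hAk : A.ncard = k) (hBk : B.ncard = k)
    (hA : ∀ u ∈ A, ∀ v ∈ A, u ≠ v → G.Adj u v) (hB : ∀ u ∈ B, ∀ v ∈ B, u ≠ v → G.Adj u v) :
    HasLinkage G A B k := by
  refine SeparationBound.hasLinkage G A B k ?_
  by_contra hcon
  unfold SeparationBound at hcon
  push Not at hcon
  obtain ⟨X₀, Y₀, h₀⟩ := hcon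
  obtain ⟨⟨X, Y⟩, ⟨hsep, hAX, hBY, hlt⟩, hmin⟩ := Set.exists_min_image
    {Z : Set V × Set V | IsSeparation G Z.1 Z.2 ∧ A ⊆ Z.1 ∧ B ⊆ Z.2 ∧ (Z.1 ∩ Z.2).ncard < k}
    (fun Z => (Z.1 ∩ Z.2).ncard) (Set.toFinite _) ⟨(X₀, Y₀), h₀⟩
  dsimp only at hsep hAX hBY hlt hmin
  have hmin' : SeparationBound G A B (X ∩ Y).ncard := by
    intro X' Y' h1 h2 h3
    by_cases h4 : (X' ∩ Y').ncard < k
    · exact hmin (X', Y') ⟨h1, h2, h3, h4⟩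
    · omega
  obtain ⟨P, hP⟩ := HasLinkage.exists_bags (G := G) hAX <|
    SeparationBound.hasLinkage (edgesWithin G X) A (X ∩ Y) _ <| by
      intro X' Y' hs hA' hT'
      refine (hmin' _ _ (hsep.of_edgesWithin hs) (Set.subset_inter hA' hAX)
        (hBY.trans Set.subset_union_right)).trans ?_
      exact Set.ncard_le_ncard (inter_union_subset_of_inter_subset hT') (Set.toFinite _)
  obtain ⟨Q, hQ⟩ := HasLinkage.exists_bags (G := G) hBY <|
    SeparationBound.hasLinkage (edgesWithin G Y) B (Y ∩ X) _ <| by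
      intro X' Y' hs hB' hT'
      rw [Set.inter_comm Y X]
      refine (hmin' _ _ (hsep.symm.of_edgesWithin hs).symm (hAX.trans Set.subset_union_right)
        (Set.subset_inter hB' hBY)).trans ?_
      rw [Set.inter_comm (Y' ∪ X)]
      exact Set.ncard_le_ncard (inter_union_subset_of_inter_subset hT') (Set.toFinite _)
  refine hG.false_of_separation hsep ?_ ?_ ?_ (contractsToClique_of_bags hA hP)
  · rintro rfl
    rw [Set.univ_inter] at hlt
    exact absurd (Set.ncard_le_ncard hBY (Set.toFinite _)) (by omega)
  · rintro rfl
    rw [Set.inter_univ] at hlt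
    exact absurd (Set.ncard_le_ncard hAX (Set.toFinite _)) (by omega)
  · rw [Set.inter_comm]
    exact contractsToClique_of_bags hB hQ

end Critical

section LinkedCliques

variable {V : Type}

/-- Two disjoint transversal `5`-cliques `a` and `b` of a partition of the vertex set into
connected parts `U i`. -/
structure LinkedCliques (G : SimpleGraph V) (a b : Fin 5 → V) (U : Fin 5 → Set V) : Prop where
  connected : ∀ i, (G.induce (U i)).Connected
  disjoint : ∀ i j, i ≠ j → Disjoint (U i) (U j)
  cover : ∀ v, ∃ i, v ∈ U i
  left_mem : ∀ i, a i ∈ U i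
  right_mem : ∀ i, b i ∈ U i
  left_adj : ∀ i j, i ≠ j → G.Adj (a i) (a j)
  right_adj : ∀ i j, i ≠ j → G.Adj (b i) (b j)
  ne : ∀ i, a i ≠ b i

namespace LinkedCliques

variable {G : SimpleGraph V} {a b : Fin 5 → V} {U : Fin 5 → Set V}

lemma symm (h : LinkedCliques G a b U) : LinkedCliques G b a U :=
  ⟨h.connected, h.disjoint, h.cover, h.right_mem, h.left_mem, h.right_adj, h.left_adj,
    fun i => (h.ne i).symm⟩

lemma eq_of_mem (h : LinkedCliques G a b U) {v : V} {i j : Fin 5} (hi : v ∈ U i) (hj : v ∈ U j) :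
    i = j := by
  by_contra hne
  exact Set.disjoint_left.1 (h.disjoint i j hne) hi hj

/-- Splitting two of the five parts suitably yields a model of `K₇` minus an edge. -/
lemma isMinor_K7vee (h : LinkedCliques G a b U) {i j : Fin 5} (hij : i ≠ j) {A B C D : Set V}
    (hAB : A ∪ B ⊆ U i) (hCD : C ∪ D ⊆ U j) (hdAB : Disjoint A B) (hdCD : Disjoint C D)
    (hA : (G.induce A).Connected) (hB : (G.induce B).Connected)
    (hC : (G.induce C).Connected) (hD : (G.induce D).Connected)
    (haA : a i ∈ A) (hbB : b i ∈ B) (haC : a j ∈ C) (hbD : b j ∈ D)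
    (hadjAB : ∃ u ∈ A, ∃ v ∈ B, G.Adj u v) (hadjCD : ∃ u ∈ C, ∃ v ∈ D, G.Adj u v)
    (hadjAD : ∃ u ∈ A, ∃ v ∈ D, G.Adj u v) : IsMinor K7vee G := by
  obtain ⟨k, l, m, hik, hil, him, hjk, hjl, hjm, hkl, hkm, hlm⟩ : ∃ k l m : Fin 5,
      i ≠ k ∧ i ≠ l ∧ i ≠ m ∧ j ≠ k ∧ j ≠ l ∧ j ≠ m ∧ k ≠ l ∧ k ≠ m ∧ l ≠ m := by
    have hfin : ∀ i j : Fin 5, i ≠ j → ∃ k l m : Fin 5, [i, j, k, l, m].Nodup := by decide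
    obtain ⟨k, l, m, hnodup⟩ := hfin i j hij
    simp only [List.nodup_cons, List.mem_cons, List.not_mem_nil, or_false, not_or] at hnodup
    exact ⟨k, l, m, by tauto⟩
  have hAi := Set.subset_union_left.trans hAB
  have hBi := Set.subset_union_right.trans hAB
  have hCj := Set.subset_union_left.trans hCD
  have hDj := Set.subset_union_right.trans hCD
  have hdij := h.disjoint i j hij
  have key : ∀ w w' : Fin 7, w < w' →
      Disjoint (![C, B, A, D, U k, U l, U m] w) (![C, B, A, D, U k, U l, U m] w') ∧
      (K7vee.Adj w w' → ∃ u ∈ ![C, B, A, D, U k, U l, U m] w,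
        ∃ v ∈ ![C, B, A, D, U k, U l, U m] w', G.Adj u v) := by
    have hleaf : ∀ {s t : Set V} {p q : Fin 5} {P : Prop}, p ≠ q → s ⊆ U p → t ⊆ U q →
        ((a p ∈ s ∧ a q ∈ t) ∨ (b p ∈ s ∧ b q ∈ t)) →
        Disjoint s t ∧ (P → ∃ u ∈ s, ∃ v ∈ t, G.Adj u v) := by
      intro s t p q P hpq hs ht hor
      refine ⟨(h.disjoint p q hpq).mono hs ht, fun _ => ?_⟩
      rcases hor with ⟨h1, h2⟩ | ⟨h1, h2⟩
      · exact ⟨_, h1, _, h2, h.left_adj p q hpq⟩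
      · exact ⟨_, h1, _, h2, h.right_adj p q hpq⟩
    have hx : ∀ {s t : Set V}, (∃ u ∈ s, ∃ v ∈ t, G.Adj u v) → ∃ u ∈ t, ∃ v ∈ s, G.Adj u v :=
      fun ⟨u, hu, v, hv, huv⟩ => ⟨v, hv, u, hu, huv.symm⟩
    have hUa := h.left_mem
    have hCb : ∀ {p : Fin 5} {P : Prop}, j ≠ p →
        Disjoint C (U p) ∧ (P → ∃ u ∈ C, ∃ v ∈ U p, G.Adj u v) :=
      fun hp => hleaf hp hCj subset_rfl (Or.inl ⟨haC, hUa _⟩)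
    have hAb : ∀ {p : Fin 5} {P : Prop}, i ≠ p →
        Disjoint A (U p) ∧ (P → ∃ u ∈ A, ∃ v ∈ U p, G.Adj u v) :=
      fun hp => hleaf hp hAi subset_rfl (Or.inl ⟨haA, hUa _⟩)
    have hBb : ∀ {p : Fin 5} {P : Prop}, i ≠ p →
        Disjoint B (U p) ∧ (P → ∃ u ∈ B, ∃ v ∈ U p, G.Adj u v) :=
      fun hp => hleaf hp hBi subset_rfl (Or.inr ⟨hbB, h.right_mem _⟩)
    have hDb : ∀ {p : Fin 5} {P : Prop}, j ≠ p →
        Disjoint D (U p) ∧ (P → ∃ u ∈ D, ∃ v ∈ U p, G.Adj u v) :=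
      fun hp => hleaf hp hDj subset_rfl (Or.inr ⟨hbD, h.right_mem _⟩)
    have hUb : ∀ {p q : Fin 5} {P : Prop}, p ≠ q →
        Disjoint (U p) (U q) ∧ (P → ∃ u ∈ U p, ∃ v ∈ U q, G.Adj u v) :=
      fun hp => hleaf hp subset_rfl subset_rfl (Or.inl ⟨hUa _, hUa _⟩)
    intro w w' hww
    fin_cases w <;> fin_cases w' <;> first
      | exact absurd hww (by decide)
      | exact ⟨(hdij.mono hBi hCj).symm, fun hK => absurd hK (by simp [K7vee])⟩
      | exact hleaf hij.symm hCj hAi (Or.inl ⟨haC, haA⟩)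
      | exact ⟨hdCD, fun _ => hadjCD⟩
      | exact ⟨hdAB.symm, fun _ => hx hadjAB⟩
      | exact hleaf hij hBi hDj (Or.inr ⟨hbB, hbD⟩)
      | exact ⟨hdij.mono hAi hDj, fun _ => hadjAD⟩
      | exact hCb hjk
      | exact hCb hjl
      | exact hCb hjm
      | exact hBb hik
      | exact hBb hil
      | exact hBb him
      | exact hAb hik
      | exact hAb hil
      | exact hAb him
      | exact hDb hjk
      | exact hDb hjl
      | exact hDb hjm
      | exact hUb hkl
      | exact hUb hkm
      | exact hUb hlm
  refine ⟨![C, B, A, D, U k, U l, U m], fun w => ?_, fun w w' hww => ?_, fun w w' hww => ?_⟩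
  · fin_cases w
    exacts [hC, hB, hA, hD, h.connected k, h.connected l, h.connected m]
  · rcases lt_or_gt_of_ne hww with hlt | hlt
    · exact (key w w' hlt).1
    · exact (key w' w hlt).1.symm
  · rcases lt_or_gt_of_ne hww.ne with hlt | hlt
    · exact (key w w' hlt).2 hww
    · obtain ⟨u, hu, v, hv, huv⟩ := (key w' w hlt).2 hww.symm
      exact ⟨v, hv, u, hu, huv.symm⟩

lemma exists_adj_reach (h : LinkedCliques G a b U) (i : Fin 5) :
    ∃ u ∈ reach G (U i \ {b i}) (a i), ∃ v ∈ U i \ reach G (U i \ {b i}) (a i), G.Adj u v := by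
  obtain ⟨u, -, v, hv, hu, hv', huv⟩ := exists_adj_leaving
    (t := reach G (U i \ {b i}) (a i)) (h.connected i) (h.left_mem i)
    (mem_reach_self ⟨h.left_mem i, h.ne i⟩) (h.right_mem i)
    (fun h' => (reach_subset _ _ _ h').2 rfl)
  exact ⟨u, hu, v, ⟨hv, hv'⟩, huv⟩

lemma not_mem_reach_of_adj (h : LinkedCliques G a b U) (hK : ¬ IsMinor K7vee G) {i j : Fin 5}
    (hij : i ≠ j) {x y : V} (hxy : G.Adj x y) (hx : x ∈ reach G (U i \ {b i}) (a i)) :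
    y ∉ reach G (U j \ {a j}) (b j) := by
  intro hy
  refine hK (h.isMinor_K7vee hij (A := reach G (U i \ {b i}) (a i))
    (B := U i \ reach G (U i \ {b i}) (a i)) (C := U j \ reach G (U j \ {a j}) (b j))
    (D := reach G (U j \ {a j}) (b j)) ?_ ?_ Set.disjoint_sdiff_right Set.disjoint_sdiff_left
    (connected_reach ⟨h.left_mem i, h.ne i⟩)
    (connected_diff_reach (h.connected i) (h.left_mem i) (h.right_mem i) (h.ne i))
    (connected_diff_reach (h.connected j) (h.right_mem j) (h.left_mem j) (h.ne j).symm)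
    (connected_reach ⟨h.right_mem j, (h.ne j).symm⟩)
    (mem_reach_self ⟨h.left_mem i, h.ne i⟩)
    ⟨h.right_mem i, fun h' => (reach_subset _ _ _ h').2 rfl⟩
    ⟨h.left_mem j, fun h' => (reach_subset _ _ _ h').2 rfl⟩
    (mem_reach_self ⟨h.right_mem j, (h.ne j).symm⟩) (h.exists_adj_reach i) ?_ ⟨x, hx, y, hy, hxy⟩)
  · exact Set.union_subset ((reach_subset _ _ _).trans Set.sdiff_subset) Set.sdiff_subset
  · exact Set.union_subset Set.sdiff_subset ((reach_subset _ _ _).trans Set.sdiff_subset)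
  · obtain ⟨u, hu, v, hv, huv⟩ := h.symm.exists_adj_reach j
    exact ⟨v, hv, u, hu, huv.symm⟩

/-- No vertex of `U i` is separated from `b i` by `a i`. -/
lemma reach_eq [Fintype V] (h : LinkedCliques G a b U) (hG : ContractionCritical7 G)
    (hK : ¬ IsMinor K7vee G) (i : Fin 5) : reach G (U i \ {a i}) (b i) = U i \ {a i} := by
  by_contra hne
  obtain ⟨m, hm, hmr⟩ : ∃ m ∈ U i \ {a i}, m ∉ reach G (U i \ {a i}) (b i) := by
    by_contra! hall
    exact hne ((reach_subset _ _ _).antisymm hall)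
  set X : Set V := {v | ∃ j, v ∈ U j ∧ v ∉ reach G (U j \ {a j}) (b j)} with hX
  have haX : Set.range a ⊆ X := by
    rintro _ ⟨j, rfl⟩
    exact ⟨j, h.left_mem j, fun h' => (reach_subset _ _ _ h').2 rfl⟩
  have hinter : X ∩ (Xᶜ ∪ Set.range a) = Set.range a := by
    rw [Set.inter_union_distrib_left, Set.inter_compl_self, Set.empty_union,
      Set.inter_eq_right.2 haX]
  have hclique : ∀ s ∈ Set.range a, ∀ t ∈ Set.range a, s ≠ t → G.Adj s t := by
    rintro _ ⟨j, rfl⟩ _ ⟨k, rfl⟩ hjk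
    exact h.left_adj j k fun h' => hjk (by rw [h'])
  refine hG.false_of_separation (X := X) (Y := Xᶜ ∪ Set.range a) ⟨?_, ?_⟩ ?_ ?_ ?_ ?_
  · rw [← Set.union_assoc, Set.union_compl_self, Set.univ_union]
  · rintro u w huw ⟨⟨⟨j, huj, hur⟩, hu⟩, -, hw⟩
    have hua : ∀ k, u ≠ a k := fun k h' => hu (Or.inr ⟨k, h'.symm⟩)
    obtain ⟨k, hwk⟩ := h.cover w
    have hwr : w ∈ reach G (U k \ {a k}) (b k) := by
      by_contra hwr
      exact hw ⟨k, hwk, hwr⟩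
    rcases eq_or_ne j k with rfl | hjk
    · exact hur (mem_reach_of_adj ⟨h.right_mem j, (h.ne j).symm⟩ hwr ⟨huj, hua j⟩ huw.symm)
    · have hur' := (mem_reach_or_mem_reach (h.connected j) (h.left_mem j) (h.right_mem j)
        (h.ne j) huj).resolve_right hur
      exact h.not_mem_reach_of_adj hK hjk huw hur' hwr
  · intro hu
    obtain ⟨j, hj, hjr⟩ : b 0 ∈ X := hu ▸ Set.mem_univ _
    obtain rfl := h.eq_of_mem hj (h.right_mem 0)
    exact hjr (mem_reach_self ⟨h.right_mem 0, (h.ne 0).symm⟩)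
  · intro hu
    have hmem : m ∈ Xᶜ ∪ Set.range a := hu ▸ Set.mem_univ m
    rcases hmem with hmem | ⟨j, rfl⟩
    · exact hmem ⟨i, hm.1, hmr⟩
    · obtain rfl := h.eq_of_mem hm.1 (h.left_mem j)
      exact hm.2 rfl
  · rw [hinter]
    exact contractsToClique_of_isClique haX hclique
  · rw [hinter]
    exact contractsToClique_of_isClique Set.subset_union_right hclique

lemma adj_of_ne [Fintype V] (h : LinkedCliques G a b U) (hG : ContractionCritical7 G)
    (hK : ¬ IsMinor K7vee G) {i j : Fin 5} (hij : i ≠ j) {x y : V} (hx : x ∈ U i) (hy : y ∈ U j)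
    (hxy : G.Adj x y) : (x = a i ∧ y = a j) ∨ (x = b i ∧ y = b j) := by
  have h1 := h.not_mem_reach_of_adj hK hij hxy
  have h2 := h.symm.not_mem_reach_of_adj hK hij hxy
  rw [h.symm.reach_eq hG hK, h.reach_eq hG hK] at h1 h2
  have := h.ne i
  have := h.ne j
  simp only [Set.mem_sdiff, Set.mem_singleton_iff, hx, hy, true_and] at h1 h2
  by_cases hxa : x = a i
  · grind
  · grind

lemma eq_or_eq [Fintype V] (h : LinkedCliques G a b U) (hG : ContractionCritical7 G)
    (hK : ¬ IsMinor K7vee G) {i : Fin 5} {m : V} (hm : m ∈ U i) : m = a i ∨ m = b i := by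
  by_contra! hne
  obtain ⟨j, hj⟩ : ∃ j : Fin 5, j ≠ i := exists_ne i
  have hajU : a j ∉ U i := fun h' => hj (h.eq_of_mem (h.left_mem j) h')
  have hpair : ({a i, b i} : Set V) ⊆ U i := by
    rintro _ (rfl | rfl)
    exacts [h.left_mem i, h.right_mem i]
  have hinter : U i ∩ ((U i)ᶜ ∪ {a i, b i}) = {a i, b i} := by
    rw [Set.inter_union_distrib_left, Set.inter_compl_self, Set.empty_union,
      Set.inter_eq_right.2 hpair]
  refine hG.false_of_separation (X := U i) (Y := (U i)ᶜ ∪ {a i, b i}) ⟨?_, ?_⟩ ?_ ?_ ?_ ?_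
  · rw [← Set.union_assoc, Set.union_compl_self, Set.univ_union]
  · rintro u w huw ⟨⟨hu, hu'⟩, -, hw⟩
    obtain ⟨k, hwk⟩ := h.cover w
    have hik : i ≠ k := by
      rintro rfl
      exact hw hwk
    rcases h.adj_of_ne hG hK hik hu hwk huw with ⟨rfl, -⟩ | ⟨rfl, -⟩
    · exact hu' (Or.inr (Or.inl rfl))
    · exact hu' (Or.inr (Or.inr rfl))
  · exact fun hu => hajU (hu ▸ Set.mem_univ _)
  · intro hu
    have hmem : m ∈ (U i)ᶜ ∪ {a i, b i} := hu ▸ Set.mem_univ m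
    rcases hmem with hmem | rfl | rfl
    exacts [hmem hm, hne.1 rfl, hne.2 rfl]
  · rw [hinter]
    refine contractsToClique_pair (T := insert (b i) (U j)) (u := a j) (h.left_mem i)
      (connected_induce_insert (h.connected j) (h.right_mem j) (h.right_adj j i hj)) ?_ ?_
      (Or.inr (h.left_mem j)) (h.left_adj i j hj.symm)
    · rw [Set.insert_inter_of_mem (h.right_mem i), (h.disjoint j i hj).inter_eq,
        insert_empty_eq]
    · rintro (h' | h')
      · exact h.ne i h'
      · exact hj (h.eq_of_mem h' (h.left_mem i))
  · rw [hinter]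
    obtain ⟨u, -, v, hv, hu, hva, huv⟩ := exists_adj_leaving (t := {a i}) (h.connected i)
      (h.left_mem i) rfl (h.right_mem i) (h.ne i).symm
    obtain rfl : u = a i := hu
    refine contractsToClique_pair (T := U i \ {a i}) (u := v) (Or.inr (Or.inl rfl)) ?_ ?_
      (fun h' => h'.2 rfl) ⟨hv, hva⟩ huv
    · rw [← h.reach_eq hG hK]
      exact connected_reach ⟨h.right_mem i, (h.ne i).symm⟩
    · ext w
      constructor
      · rintro ⟨⟨hw, hwa⟩, hw' | rfl | rfl⟩
        · exact absurd hw hw'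
        · exact absurd rfl hwa
        · rfl
      · rintro rfl
        exact ⟨⟨h.right_mem i, (h.ne i).symm⟩, Or.inr (Or.inr rfl)⟩

lemma not_linkedCliques [Fintype V] (hG : ContractionCritical7 G) (hK : ¬ IsMinor K7vee G) :
    ¬ LinkedCliques G a b U := by
  classical
  intro h
  choose f hf using h.cover
  have hfa : ∀ i, f (a i) = i := fun i => h.eq_of_mem (hf _) (h.left_mem i)
  have hfb : ∀ i, f (b i) = i := fun i => h.eq_of_mem (hf _) (h.right_mem i)
  refine hG.not_colorable (Colorable.mono (n := 5) (by norm_num)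
    ⟨Coloring.mk (fun v => if v = a (f v) then f v else f v + 1) ?_⟩)
  intro u v huv
  rcases eq_or_ne (f u) (f v) with hfuv | hfuv
  · have h1 := h.eq_or_eq hG hK (hf u)
    have h2 := h.eq_or_eq hG hK (hf v)
    have h3 := huv.ne
    have h4 : f v ≠ f v + 1 := by
      generalize f v = k
      revert k
      decide
    have h5 := h.ne (f v)
    rw [hfuv] at h1 ⊢
    grind
  · rcases h.adj_of_ne hG hK hfuv (hf u) (hf v) huv with ⟨h1, h2⟩ | ⟨h1, h2⟩
    · rw [if_pos h1, if_pos h2]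
      exact hfuv
    · rw [if_neg (by rw [h1, hfb]; exact (h.ne _).symm),
        if_neg (by rw [h2, hfb]; exact (h.ne _).symm)]
      exact fun h' => hfuv (add_right_cancel h')

end LinkedCliques

lemma ContractionCritical7.exists_adj_of_nonempty [Fintype V] {G : SimpleGraph V}
    (hG : ContractionCritical7 G) {X : Set V} (hX : X.Nonempty) (hXu : X ≠ Set.univ) :
    ∃ u ∈ X, ∃ v ∉ X, G.Adj u v := by
  by_contra! hno
  refine hG.false_of_separation (X := X) (Y := Xᶜ)
    ⟨Set.union_compl_self X, fun u v huv hh => hno u hh.1.1 v hh.2.1 huv⟩ hXu ?_ ?_ ?_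
  · rwa [Ne, Set.compl_univ_iff, ← Ne, ← Set.nonempty_iff_ne_empty]
  all_goals
    rw [Set.inter_compl_self]
    exact contractsToClique_of_isClique (Set.empty_subset _) fun _ h => h.elim

/-- In a contraction-critical graph, disjoint connected sets extend to a partition of the vertex
set into connected sets. -/
lemma ContractionCritical7.exists_connected_partition [Fintype V] {G : SimpleGraph V}
    (hG : ContractionCritical7 G) {k : ℕ} [NeZero k] (P : Fin k → Set V)
    (hc : ∀ i, (G.induce (P i)).Connected) (hd : ∀ i j, i ≠ j → Disjoint (P i) (P j)) :
    ∃ U : Fin k → Set V, (∀ i, (G.induce (U i)).Connected) ∧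
      (∀ i j, i ≠ j → Disjoint (U i) (U j)) ∧ (∀ v, ∃ i, v ∈ U i) ∧ ∀ i, P i ⊆ U i := by
  classical
  obtain ⟨U, ⟨hUc, hUd, hPU⟩, hmax⟩ := Set.exists_max_image
    {U : Fin k → Set V | (∀ i, (G.induce (U i)).Connected) ∧
      (∀ i j, i ≠ j → Disjoint (U i) (U j)) ∧ ∀ i, P i ⊆ U i}
    (fun U => (⋃ i, U i).ncard) (Set.toFinite _) ⟨P, hc, hd, fun _ => subset_rfl⟩
  refine ⟨U, hUc, hUd, ?_, hPU⟩
  by_contra! hv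
  obtain ⟨v₀, hv₀⟩ := hv
  obtain ⟨x, hx⟩ := (hUc 0).nonempty
  obtain ⟨u, hu, v, hv, huv⟩ := hG.exists_adj_of_nonempty (X := ⋃ i, U i)
    ⟨x, Set.mem_iUnion.2 ⟨0, hx⟩⟩
    (fun h => (Set.mem_iUnion.1 (h ▸ Set.mem_univ v₀ : v₀ ∈ ⋃ i, U i)).elim fun i hi => hv₀ i hi)
  obtain ⟨i, hui⟩ := Set.mem_iUnion.1 hu
  have hvU : ∀ j, v ∉ U j := fun j hj => hv (Set.mem_iUnion.2 ⟨j, hj⟩)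
  obtain ⟨U', hU'i, hU'⟩ : ∃ U' : Fin k → Set V, U' i = insert v (U i) ∧
      ∀ j, j ≠ i → U' j = U j :=
    ⟨Function.update U i (insert v (U i)), Function.update_self _ _ _,
      fun j hj => Function.update_of_ne hj _ _⟩
  have hUU' : ∀ j, U j ⊆ U' j := by
    intro j
    rcases eq_or_ne j i with rfl | hj
    · rw [hU'i]
      exact Set.subset_insert _ _
    · rw [hU' j hj]
  have hmem : v ∈ ⋃ j, U' j := Set.mem_iUnion.2 ⟨i, hU'i ▸ Set.mem_insert _ _⟩
  have hle := hmax U' ⟨fun j => ?_, fun j l hjl => ?_, fun j => (hPU j).trans (hUU' j)⟩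
  · refine absurd hle (not_le.2 (Set.ncard_lt_ncard ?_ (Set.toFinite _)))
    exact ⟨Set.iUnion_mono hUU', fun h => hv (h hmem)⟩
  · rcases eq_or_ne j i with rfl | hj
    · rw [hU'i]
      exact connected_induce_insert (hUc j) hui huv
    · rw [hU' j hj]
      exact hUc j
  · rcases eq_or_ne j i with rfl | hj
    · rw [hU'i, hU' l hjl.symm, Set.disjoint_insert_left]
      exact ⟨hvU l, hUd j l hjl⟩
    · rcases eq_or_ne l i with rfl | hl
      · rw [hU'i, hU' j hj, Set.disjoint_insert_right]
        exact ⟨hvU j, hUd j l hjl⟩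
      · rw [hU' j hj, hU' l hl]
        exact hUd j l hjl

end LinkedCliques

/-- in a 7-contraction-critical graph with no `K7vee`-minor, any two
5-cliques have nonempty intersection. -/
theorem statement_19 (V : Type) [Fintype V] [DecidableEq V] (G : SimpleGraph V)
    (hcrit : ContractionCritical7 G) (hminor : ¬ IsMinor K7vee G)
    (L₁ L₂ : Finset V) (h₁ : G.IsNClique 5 L₁) (h₂ : G.IsNClique 5 L₂) :
    (L₁ ∩ L₂).Nonempty := by
  by_contra hcon
  rw [Finset.not_nonempty_iff_eq_empty, ← Finset.disjoint_iff_inter_eq_empty] at hcon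
  have hA : ∀ u ∈ (L₁ : Set V), ∀ v ∈ (L₁ : Set V), u ≠ v → G.Adj u v :=
    fun u hu v hv huv => h₁.isClique hu hv huv
  have hB : ∀ u ∈ (L₂ : Set V), ∀ v ∈ (L₂ : Set V), u ≠ v → G.Adj u v :=
    fun u hu v hv huv => h₂.isClique hu hv huv
  obtain ⟨P, hc, hd, hPA, hPB⟩ := hcrit.hasLinkage (k := 5)
    (by rw [Set.ncard_coe_finset, h₁.card_eq]) (by rw [Set.ncard_coe_finset, h₂.card_eq]) hA hB
  obtain ⟨U, hUc, hUd, hcover, hPU⟩ := hcrit.exists_connected_partition P hc hd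
  choose a ha using hPA
  choose b hb using hPB
  have hne : ∀ {f : Fin 5 → V}, (∀ i, f i ∈ P i) → ∀ i j, i ≠ j → f i ≠ f j :=
    fun hf i j hij h => Set.disjoint_left.1 (hd i j hij) (hf i) (h ▸ hf j)
  refine LinkedCliques.not_linkedCliques (a := a) (b := b) (U := U) hcrit hminor
    ⟨hUc, hUd, hcover, fun i => hPU i (ha i).1, fun i => hPU i (hb i).1,
      fun i j hij => hA _ (ha i).2 _ (ha j).2 (hne (fun i => (ha i).1) i j hij),
      fun i j hij => hB _ (hb i).2 _ (hb j).2 (hne (fun i => (hb i).1) i j hij), fun i h => ?_⟩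
  exact Finset.disjoint_left.1 hcon (ha i).2 (h ▸ (hb i).2)
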